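/- For every integer n ≥ 0, 2^n · d_n(x) = Σ_{k=0}^{n} C(n,k) · R_k(x) · R_{n−k}(x) as an identity of polynomials in x, where C(n,k) is the binomial coefficient. -/

import Mathlib

open scoped Classical
noncomputable section

/-- The multiset `{1,1,2,2,…,n,n}` as a list. -/
def baseList (n : ℕ) : List ℕ := (List.range n).flatMap (fun i => [i + 1, i + 1])

/-- A word is Stirling if whenever the same value occurs at positions `i < k`,
every entry strictly between them is greater than that value. -/
def IsStirlingWord (l : List ℕ) : Prop :=
  ∀ i j k : Fin l.length, i < j → j < k → l.get i = l.get k → l.get i < l.get j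

/-- The set `Q_n` of Stirling permutations of order `n`:  rearrangements of the
multiset `{1,1,2,2,…,n,n}` in which all entries between the two occurrences of any
value exceed that value. -/
def stirlingPerms (n : ℕ) : Finset (List ℕ) :=
  ((baseList n).permutations.toFinset).filter IsStirlingWord

/-- Number of descents of `σ ∈ Q_n`: indices `i ∈ {1,…,2n}` (here 0-based) with
`σ_i > σ_{i+1}`, with the convention `σ_{2n+1} = 0`. -/
def desList (l : List ℕ) : ℕ :=
  ((Finset.range l.length).filter (fun i => l.getD (i + 1) 0 < l.getD i 0)).card

/-- The second-order Eulerian polynomial `C_n(x) = ∑_{σ ∈ Q_n} x^{des σ}`. -/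
def Cpoly (n : ℕ) : Polynomial ℚ :=
  ∑ σ ∈ stirlingPerms n, Polynomial.X ^ desList σ

/-- A list of cycles is a valid standard cycle form of a Stirling permutation of the
second kind of order `n` if:  the cycles are disjoint and together use each of
`1,1,2,2,…,n,n` exactly once; both copies of any value lie in the same cycle; each
cycle starts with (one of) its smallest entries; the cycles are listed in increasing
order of their smallest (first) entries; and the word of each cycle reduces to a
Stirling permutation. -/
def IsStirling2 (n : ℕ) (c : List (List ℕ)) : Prop :=
  c.flatten.Perm (baseList n) ∧
  (∀ w ∈ c, w ≠ [] ∧ (∀ v ∈ w, w.count v = 2) ∧ (∀ v ∈ w, w.headI ≤ v) ∧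
      IsStirlingWord w) ∧
  c.Chain' (fun w₁ w₂ => w₁.headI < w₂.headI)

/-- The set `Q_n²` of Stirling permutations of the second kind of order `n`,
each recorded as its standard cycle form (a list of cycles). -/
def stirling2 (n : ℕ) : Finset (List (List ℕ)) :=
  ((((baseList n).permutations.toFinset) ×ˢ (Finset.univ : Finset (Composition (2 * n)))).image
      (fun p => p.1.splitWrtComposition p.2)).filter (IsStirling2 n)

/-- `cyc(σ)`: the number of cycles. -/
def cyc (c : List (List ℕ)) : ℕ := c.length

/-- `cplat(σ)`: the number of cycle plateaus, i.e. entries `c_i` of a cycle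
`(c_1,…,c_{2k})` with `c_i = c_{i+1}`, `1 ≤ i < 2k`. -/
def cplat (c : List (List ℕ)) : ℕ :=
  (c.map (fun w => ((Finset.range w.length).filter
    (fun i => i + 1 < w.length ∧ w.getD i 0 = w.getD (i + 1) 0)).card)).sum

/-- `casc(σ)`: the number of cycle ascents, i.e. entries `c_i` of a cycle
`(c_1,…,c_{2k})` with `c_i < c_{i+1}`, `1 ≤ i < 2k`. -/
def casc (c : List (List ℕ)) : ℕ :=
  (c.map (fun w => ((Finset.range w.length).filter
    (fun i => i + 1 < w.length ∧ w.getD i 0 < w.getD (i + 1) 0)).card)).sum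

/-- `cap(σ)`: the number of cycle ascent plateaus, i.e. entries `c_i` of a cycle
`(c_1,…,c_{2k})` with `c_{i-1} < c_i = c_{i+1}`, `2 ≤ i ≤ 2k-1`. -/
def capSt (c : List (List ℕ)) : ℕ :=
  (c.map (fun w => ((Finset.range w.length).filter
    (fun i => 0 < i ∧ i + 1 < w.length ∧
      w.getD (i - 1) 0 < w.getD i 0 ∧ w.getD i 0 = w.getD (i + 1) 0)).card)).sum

/-- `fix(σ)`: the number of fixed points, i.e. values `k` with `(k,k)` a cycle of `σ`. -/
def fixSt (c : List (List ℕ)) : ℕ :=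
  ((Finset.range c.length).filter (fun i => ∃ k : ℕ, c.getD i [] = [k, k])).card

/-- Number of excedances of a permutation: indices `i` with `π(i) > i`. -/
def exc (n : ℕ) (π : Equiv.Perm (Fin n)) : ℕ :=
  (Finset.univ.filter (fun i : Fin n => i < π i)).card

/-- The derangement polynomial `d_n(x) = ∑_{π derangement of [n]} x^{exc(π)}`,
with `d_0 = 1`. -/
def dpoly (n : ℕ) : Polynomial ℚ :=
  ∑ π ∈ Finset.univ.filter (fun π : Equiv.Perm (Fin n) => ∀ i, π i ≠ i),
    Polynomial.X ^ exc n π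

/-- The Stirling derangement polynomial `R_n(x) = ∑_{σ ∈ DQ_n} x^{cap(σ)}`, summed over
fixed-point-free Stirling permutations of the second kind of order `n`, with `R_0 = 1`. -/
def Rx (n : ℕ) : Polynomial ℚ :=
  ∑ σ ∈ (stirling2 n).filter (fun σ => fixSt σ = 0), Polynomial.X ^ capSt σ

/-! ### The generating ring and its derivation -/

/-- The ring in which weights live: variable `0` marks excedances (or cycle ascent plateaus),
variable `1` marks fixed points, variable `2` marks the remaining letters. -/
abbrev WeightRing : Type := MvPolynomial (Fin 3) ℚ

/-- The derivation sending every variable to `X 0 * X 2`. -/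
def grammarDer : Derivation ℚ WeightRing WeightRing :=
  MvPolynomial.mkDerivation ℚ fun _ => MvPolynomial.X 0 * MvPolynomial.X 2

lemma grammarDer_X (i : Fin 3) :
    grammarDer (MvPolynomial.X i) = MvPolynomial.X 0 * MvPolynomial.X 2 :=
  MvPolynomial.mkDerivation_X ..

/-- Specialization `X 0 ↦ X`, `X 1 ↦ 0`, `X 2 ↦ 1`, killing all weights with a fixed point. -/
def killFixed : WeightRing →ₐ[ℚ] Polynomial ℚ :=
  MvPolynomial.aeval ![Polynomial.X, 0, 1]

lemma killFixed_X (i : Fin 3) :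
    killFixed (MvPolynomial.X i) = (![Polynomial.X, 0, 1] : Fin 3 → Polynomial ℚ) i :=
  MvPolynomial.aeval_X ..

lemma leibniz_prod {ι : Type*} [DecidableEq ι] (s : Finset ι) (f : ι → WeightRing) :
    grammarDer (∏ i ∈ s, f i) = ∑ i ∈ s, grammarDer (f i) * ∏ j ∈ s.erase i, f j := by
  induction s using Finset.induction_on with
  | empty => simp
  | insert a s ha ih =>
    rw [Finset.prod_insert ha, Derivation.leibniz, ih, Finset.sum_insert ha,
      Finset.erase_insert ha, smul_eq_mul, smul_eq_mul, add_comm, mul_comm]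
    congr 1
    rw [Finset.mul_sum]
    refine Finset.sum_congr rfl fun i hi => ?_
    have hai : a ≠ i := fun h => ha (h ▸ hi)
    rw [Finset.erase_insert_of_ne hai, Finset.prod_insert (by simp [ha])]
    ring

/-! ### Binomial convolution of solutions of a derivation recurrence -/

lemma convolution_recurrence {A : Type*} [CommRing A] [Algebra ℚ A] (D : Derivation ℚ A A)
    (y : A) (P Q : ℕ → A) (hP0 : P 0 = 1) (hQ0 : Q 0 = 1)
    (hP : ∀ n, P (n + 1) = y * P n + D (P n))
    (hQ : ∀ n, Q (n + 1) = y * Q n + 2 * D (Q n)) (n : ℕ) :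
    (2 : A) ^ n * P n = ∑ k ∈ Finset.range (n + 1), (n.choose k : A) * Q k * Q (n - k) := by
  simp only [mul_assoc]
  rw [← Finset.Nat.sum_antidiagonal_eq_sum_range_succ
    (fun i j => (n.choose i : A) * (Q i * Q j)) n]
  induction n with
  | zero => simp [hP0, hQ0]
  | succ n ih =>
    rw [Finset.sum_antidiagonal_choose_succ_mul (fun i j => Q i * Q j) n,
      ← Finset.sum_add_distrib]
    have key : (2 : A) ^ (n + 1) * P (n + 1)
        = 2 * (y * (2 ^ n * P n)) + 2 * D (2 ^ n * P n) := by
      have h2 : D ((2 : A) ^ n) = 0 := by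
        have := D.map_natCast (2 ^ n)
        push_cast at this
        exact this
      rw [hP, D.leibniz, h2, pow_succ]
      simp only [smul_eq_mul]
      ring
    rw [key, ih, map_sum, Finset.mul_sum, Finset.mul_sum, Finset.mul_sum,
      ← Finset.sum_add_distrib]
    refine Finset.sum_congr rfl fun p hp => ?_
    have hc : (n.choose p.2 : A) = n.choose p.1 := by
      rw [← Nat.choose_symm_of_eq_add (Finset.HasAntidiagonal.mem_antidiagonal.1 hp).symm]
    rw [hc, D.leibniz, D.leibniz, D.map_natCast, hQ, hQ]
    simp only [smul_eq_mul]
    ring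

/-! ### Permutations -/

/-- The variable recording how `π i` compares with `i`. -/
def letterWeight {α : Type*} [LinearOrder α] (i j : α) : WeightRing :=
  if i < j then MvPolynomial.X 0 else if i = j then MvPolynomial.X 1 else MvPolynomial.X 2

lemma grammarDer_letterWeight {α : Type*} [LinearOrder α] (i j : α) :
    grammarDer (letterWeight i j) = MvPolynomial.X 0 * MvPolynomial.X 2 := by
  unfold letterWeight
  split_ifs <;> exact grammarDer_X _

/-- The weight of a permutation. -/
def permWeight {n : ℕ} (π : Equiv.Perm (Fin n)) : WeightRing := ∏ i, letterWeight i (π i)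

/-- The generating polynomial of all permutations of `Fin n`. -/
def permPoly (n : ℕ) : WeightRing := ∑ π : Equiv.Perm (Fin n), permWeight π

lemma permWeight_decomposeFin_zero {n : ℕ} (e : Equiv.Perm (Fin n)) :
    permWeight (Equiv.Perm.decomposeFin.symm (0, e)) = MvPolynomial.X 1 * permWeight e := by
  simp [permWeight, Fin.prod_univ_succ, letterWeight]

lemma permWeight_decomposeFin_succ {n : ℕ} (e : Equiv.Perm (Fin n)) (i : Fin n) :
    permWeight (Equiv.Perm.decomposeFin.symm ((e i).succ, e)) =
      grammarDer (letterWeight i (e i)) *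
        ∏ j ∈ Finset.univ.erase i, letterWeight j (e j) := by
  rw [permWeight, Fin.prod_univ_succ, ← Finset.mul_prod_erase Finset.univ _ (Finset.mem_univ i),
    grammarDer_letterWeight, ← mul_assoc]
  refine congrArg₂ (· * ·) ?_ ?_
  · simp [letterWeight]
  · refine Finset.prod_congr rfl fun j hj => ?_
    have hji : j ≠ i := (Finset.mem_erase.1 hj).1
    rw [Equiv.Perm.decomposeFin_symm_apply_succ, Equiv.swap_apply_of_ne_of_ne]
    · simp [letterWeight]
    · exact Fin.succ_ne_zero _
    · simpa using hji

lemma permPoly_succ (n : ℕ) :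
    permPoly (n + 1) = MvPolynomial.X 1 * permPoly n + grammarDer (permPoly n) := by
  rw [permPoly, ← Equiv.sum_comp Equiv.Perm.decomposeFin.symm, Fintype.sum_prod_type_right,
    permPoly, map_sum, Finset.mul_sum, ← Finset.sum_add_distrib]
  refine Finset.sum_congr rfl fun e _ => ?_
  rw [Fin.sum_univ_succ, permWeight_decomposeFin_zero]
  congr 1
  rw [← Equiv.sum_comp e, permWeight, leibniz_prod]
  exact Finset.sum_congr rfl fun i _ => permWeight_decomposeFin_succ e i

lemma killFixed_permPoly (n : ℕ) : killFixed (permPoly n) = dpoly n := by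
  rw [permPoly, dpoly, map_sum, Finset.sum_filter]
  refine Finset.sum_congr rfl fun π _ => ?_
  rw [permWeight, map_prod]
  split_ifs with h
  · rw [exc, ← Finset.prod_const, Finset.prod_filter]
    refine Finset.prod_congr rfl fun i _ => ?_
    have hi := (h i).symm
    unfold letterWeight
    split_ifs <;> simp_all [killFixed_X]
  · push Not at h
    obtain ⟨i, hi⟩ := h
    exact Finset.prod_eq_zero (Finset.mem_univ i) (by simp [letterWeight, hi, killFixed_X])

/-! ### Ascent plateaus of words and insertion of a new largest letter -/

/-- Number of ascent plateaus of a word, by recursion. -/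
def ascPlat : List ℕ → ℕ
  | a :: b :: c :: l => (if a < b ∧ b = c then 1 else 0) + ascPlat (b :: c :: l)
  | _ => 0

lemma ascPlat_cons₃ (a b c : ℕ) (l : List ℕ) :
    ascPlat (a :: b :: c :: l) = (if a < b ∧ b = c then 1 else 0) + ascPlat (b :: c :: l) := by
  rw [ascPlat]

lemma ascPlat_pair (a b : ℕ) : ascPlat [a, b] = 0 := by simp [ascPlat]

lemma card_filter_eq_ascPlat (w : List ℕ) :
    ((Finset.range w.length).filter (fun i => 0 < i ∧ i + 1 < w.length ∧
      w.getD (i - 1) 0 < w.getD i 0 ∧ w.getD i 0 = w.getD (i + 1) 0)).card = ascPlat w := by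
  simp only [Finset.card_filter]
  induction w with
  | nil => simp [ascPlat]
  | cons a t ih =>
    match t, ih with
    | [], _ => simp [ascPlat]
    | [b], _ =>
      simp only [ascPlat]
      refine Finset.sum_eq_zero fun i _ => if_neg ?_
      simp only [List.length_cons, List.length_nil]
      omega
    | b :: c :: l, ih =>
      rw [ascPlat_cons₃, ← ih, List.length_cons (as := b :: c :: l), Finset.sum_range_succ',
        List.length_cons (as := c :: l), Finset.sum_range_succ',
        Finset.sum_range_succ' _ (c :: l).length]
      simp
      ring

lemma two_mul_ascPlat_le : ∀ w : List ℕ, 2 * ascPlat w ≤ w.length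
  | [] => by simp [ascPlat]
  | [_] => by simp [ascPlat]
  | [_, _] => by simp [ascPlat]
  | a :: b :: c :: l => by
    rw [ascPlat_cons₃]
    by_cases h : a < b ∧ b = c
    · obtain ⟨h1, rfl⟩ := h
      have ih := two_mul_ascPlat_le (b :: l)
      have : ascPlat (b :: b :: l) = ascPlat (b :: l) := by cases l <;> simp [ascPlat]
      simp only [List.length_cons] at ih ⊢
      split_ifs <;> omega
    · have ih := two_mul_ascPlat_le (b :: c :: l)
      simp only [List.length_cons, if_neg h] at ih ⊢
      omega

/-- All words obtained from a word by inserting `m m` right after one of its letters. -/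
def insertWord (m : ℕ) : List ℕ → List (List ℕ)
  | [] => []
  | a :: w => (a :: m :: m :: w) :: (insertWord m w).map (a :: ·)

lemma mem_insertWord {m : ℕ} {w w' : List ℕ} :
    w' ∈ insertWord m w ↔ ∃ u v, u ≠ [] ∧ w = u ++ v ∧ w' = u ++ m :: m :: v := by
  induction w generalizing w' with
  | nil => simp +contextual [insertWord]
  | cons a w ih =>
    simp only [insertWord, List.mem_cons, List.mem_map, ih]
    constructor
    · rintro (rfl | ⟨_, ⟨u, v, hu, rfl, rfl⟩, rfl⟩)
      · exact ⟨[a], w, by simp⟩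
      · exact ⟨a :: u, v, by simp⟩
    · rintro ⟨u, v, hu, hw, rfl⟩
      match u, hu with
      | [b], _ => simp_all
      | b :: c :: u, _ =>
        simp only [List.cons_append, List.cons.injEq] at hw
        exact Or.inr ⟨_, ⟨c :: u, v, by simp, by simpa using hw.2, rfl⟩, by simp [hw.1]⟩

/-- Summing over all insertions of a large letter into a word: two insertions for each ascent
plateau keep the number of ascent plateaus, all others raise it by one. -/
lemma sum_insertWord {A : Type*} [CommRing A] (m : ℕ) (w : List ℕ) (hw : w ≠ [])
    (hm : ∀ a ∈ w, a < m) (g : ℕ → A) :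
    ((insertWord m w).map (fun w' => g (ascPlat w'))).sum =
      2 * ascPlat w * g (ascPlat w) + (w.length - 2 * ascPlat w) * g (ascPlat w + 1) := by
  induction w generalizing g with
  | nil => simp at hw
  | cons a t ih =>
    match t, ih with
    | [], _ => simp_all [insertWord, ascPlat]
    | [b], _ =>
      have h1 : a < m := hm a (by simp)
      have h2 : b < m := hm b (by simp)
      simp [insertWord, ascPlat, h1, h2, h2.ne, h2.ne']
      ring
    | b :: c :: l, ih =>
      have ha : a < m := hm a (by simp)
      have hb : b < m := hm b (by simp)
      have hc : c < m := hm c (by simp)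
      have ihg := ih (by simp) (fun x hx => hm x (by simp_all))
        (fun k => g ((if a < b ∧ b = c then 1 else 0) + k))
      have e1 : ascPlat (a :: m :: m :: b :: c :: l) = 1 + ascPlat (b :: c :: l) := by
        simp [ascPlat_cons₃, ha, hb.ne', hb.not_gt]
      have e2 : ascPlat (b :: m :: m :: c :: l) = 1 + ascPlat (c :: l) := by
        cases l <;> simp [ascPlat, hb, hc.ne', hc.not_gt]
      have e3 : ascPlat (a :: b :: m :: m :: c :: l) = 1 + ascPlat (c :: l) := by
        simp [ascPlat_cons₃, ← e2, hb.ne]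
      have e4 : ∀ s ∈ insertWord m (c :: l), ascPlat (a :: b :: s) =
          (if a < b ∧ b = c then 1 else 0) + ascPlat (b :: s) := by
        intro s hs
        obtain ⟨u, v, hu, hw, rfl⟩ := mem_insertWord.1 hs
        match u, hu with
        | d :: u, _ =>
          obtain ⟨rfl, -⟩ := List.cons.inj hw
          rw [List.cons_append, ascPlat_cons₃]
      have e5 : ((insertWord m (c :: l)).map (fun s => g (ascPlat (a :: b :: s)))).sum =
          ((insertWord m (c :: l)).map
            (fun s => g ((if a < b ∧ b = c then 1 else 0) + ascPlat (b :: s)))).sum :=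
        congrArg _ (List.map_congr_left fun s hs => by rw [e4 s hs])
      have i1 : insertWord m (b :: c :: l) =
        (b :: m :: m :: c :: l) :: (insertWord m (c :: l)).map (b :: ·) := by rw [insertWord]
      rw [i1] at ihg
      rw [insertWord, i1]
      simp only [List.map_cons, List.map_map, List.sum_cons, Function.comp_def, e1, e2, e3] at ihg ⊢
      rw [e5, ascPlat_cons₃]
      by_cases h : a < b ∧ b = c
      · have e6 : ascPlat (b :: c :: l) = ascPlat (c :: l) := by
          rw [h.2]; cases l <;> simp [ascPlat]
        simp only [if_pos h, e6, List.length_cons] at ihg ⊢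
        push_cast at ihg ⊢
        have r1 : 1 + ascPlat (c :: l) + 1 = 1 + (1 + ascPlat (c :: l)) := by ring
        have r2 : 1 + (ascPlat (c :: l) + 1) = 1 + (1 + ascPlat (c :: l)) := by ring
        rw [r2] at ihg
        rw [r1]
        linear_combination ihg
      · simp only [if_neg h, zero_add, List.length_cons] at ihg ⊢
        push_cast at ihg ⊢
        rw [add_comm 1 (ascPlat (b :: c :: l))]
        linear_combination ihg

/-- The weight of a cycle. -/
def wordWeight (w : List ℕ) : WeightRing :=
  if ∃ k, w = [k, k] then MvPolynomial.X 1
  else MvPolynomial.X 0 ^ ascPlat w * MvPolynomial.X 2 ^ (w.length / 2 - ascPlat w)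

lemma grammarDer_monomial (a b : ℕ) :
    grammarDer (MvPolynomial.X 0 ^ a * MvPolynomial.X 2 ^ b) =
      (a : WeightRing) * (MvPolynomial.X 0 ^ a * MvPolynomial.X 2 ^ (b + 1)) +
        (b : WeightRing) * (MvPolynomial.X 0 ^ (a + 1) * MvPolynomial.X 2 ^ b) := by
  rw [Derivation.leibniz, Derivation.leibniz_pow, Derivation.leibniz_pow, grammarDer_X,
    grammarDer_X]
  simp only [smul_eq_mul, nsmul_eq_mul]
  rcases a with _ | a <;> rcases b with _ | b <;>
    simp only [Nat.add_sub_cancel, Nat.cast_zero, zero_mul, mul_zero] <;> ring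

lemma sum_wordWeight_insertWord (m : ℕ) (w : List ℕ) (hw : w ≠ []) (he : Even w.length)
    (hm : ∀ a ∈ w, a < m) :
    ((insertWord m w).map wordWeight).sum = 2 * grammarDer (wordWeight w) := by
  have h1 : (insertWord m w).map wordWeight = (insertWord m w).map (fun w' =>
      (MvPolynomial.X 0 ^ ascPlat w' *
        MvPolynomial.X 2 ^ (w.length / 2 + 1 - ascPlat w') : WeightRing)) := by
    refine List.map_congr_left fun w' hw' => ?_
    obtain ⟨u, v, hu, rfl, rfl⟩ := mem_insertWord.1 hw'
    have hlen : (u ++ m :: m :: v).length = (u ++ v).length + 2 := by simp; ring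
    have hpos := List.length_pos_iff.2 hw
    rw [wordWeight, if_neg, hlen, Nat.add_div_right _ two_pos]
    rintro ⟨k, hk⟩
    rw [hk] at hlen
    simp only [List.length_cons, List.length_nil] at hlen
    omega
  rw [h1, sum_insertWord m w hw hm
    (fun k => MvPolynomial.X 0 ^ k * MvPolynomial.X 2 ^ (w.length / 2 + 1 - k))]
  have hle := two_mul_ascPlat_le w
  obtain ⟨h, hh⟩ := he
  have hh2 : w.length / 2 = h := by omega
  rw [wordWeight, hh2]
  split_ifs with hfix
  · obtain ⟨k, rfl⟩ := hfix
    obtain rfl : h = 1 := by simp at hh; omega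
    rw [grammarDer_X]
    simp [ascPlat_pair]
  · obtain ⟨r, rfl⟩ : ∃ r, h = ascPlat w + r := Nat.exists_eq_add_of_le (by omega)
    rw [hh]
    have q1 : ascPlat w + r + 1 - ascPlat w = r + 1 := by omega
    have q2 : ascPlat w + r + 1 - (ascPlat w + 1) = r := by omega
    rw [q1, q2, Nat.add_sub_cancel_left, grammarDer_monomial]
    push_cast
    ring

/-! ### Insertion into lists of cycles -/

/-- All cycle lists obtained by inserting `m m` after a letter of one of the cycles. -/
def insertCycles (m : ℕ) : List (List ℕ) → List (List (List ℕ))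
  | [] => []
  | w :: c => (insertWord m w).map (· :: c) ++ (insertCycles m c).map (w :: ·)

lemma mem_insertCycles {m : ℕ} {c c' : List (List ℕ)} :
    c' ∈ insertCycles m c ↔ ∃ c₁ c₂ u v, u ≠ [] ∧ c = c₁ ++ (u ++ v) :: c₂ ∧
      c' = c₁ ++ (u ++ m :: m :: v) :: c₂ := by
  induction c generalizing c' with
  | nil => simp [insertCycles]
  | cons w c ih =>
    simp only [insertCycles, List.mem_append, List.mem_map, ih, mem_insertWord]
    constructor
    · rintro (⟨_, ⟨u, v, hu, rfl, rfl⟩, rfl⟩ | ⟨_, ⟨c₁, c₂, u, v, hu, rfl, rfl⟩, rfl⟩)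
      · exact ⟨[], c, u, v, by simp [hu]⟩
      · exact ⟨w :: c₁, c₂, u, v, by simp [hu]⟩
    · rintro ⟨c₁, c₂, u, v, hu, hc, rfl⟩
      match c₁ with
      | [] =>
        obtain ⟨rfl, rfl⟩ := List.cons.inj hc
        exact Or.inl ⟨_, ⟨u, v, hu, rfl, rfl⟩, rfl⟩
      | w' :: c₁ =>
        obtain ⟨rfl, rfl⟩ := List.cons.inj hc
        exact Or.inr ⟨_, ⟨c₁, c₂, u, v, hu, rfl, rfl⟩, rfl⟩

/-- The weight of a list of cycles. -/
def cyclesWeight (c : List (List ℕ)) : WeightRing := (c.map wordWeight).prod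

lemma sum_cyclesWeight_insertCycles (m : ℕ) (c : List (List ℕ))
    (hc : ∀ w ∈ c, w ≠ [] ∧ Even w.length ∧ ∀ a ∈ w, a < m) :
    ((insertCycles m c).map cyclesWeight).sum = 2 * grammarDer (cyclesWeight c) := by
  induction c with
  | nil => simp [insertCycles, cyclesWeight]
  | cons w c ih =>
    obtain ⟨h1, h2, h3⟩ := hc w (by simp)
    have ih := ih fun w hw => hc w (by simp [hw])
    have hs := sum_wordWeight_insertWord m w h1 h2 h3
    have hcons : ∀ w c, cyclesWeight (w :: c) = wordWeight w * cyclesWeight c := by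
      simp [cyclesWeight]
    rw [insertCycles, List.map_append, List.sum_append, List.map_map, List.map_map]
    simp only [Function.comp_def, hcons]
    rw [List.sum_map_mul_right, List.sum_map_mul_left, hs, ih, Derivation.leibniz]
    simp only [smul_eq_mul]
    ring

/-- All cycle lists obtained from `c` by inserting the largest letter `m` twice. -/
def insertLetter (m : ℕ) (c : List (List ℕ)) : List (List (List ℕ)) :=
  (c ++ [[m, m]]) :: insertCycles m c

lemma sum_cyclesWeight_insertLetter (m : ℕ) (c : List (List ℕ))
    (hc : ∀ w ∈ c, w ≠ [] ∧ Even w.length ∧ ∀ a ∈ w, a < m) :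
    ((insertLetter m c).map cyclesWeight).sum =
      MvPolynomial.X 1 * cyclesWeight c + 2 * grammarDer (cyclesWeight c) := by
  rw [insertLetter, List.map_cons, List.sum_cons, sum_cyclesWeight_insertCycles m c hc]
  congr 1
  simp [cyclesWeight, wordWeight, mul_comm]

lemma killFixed_cyclesWeight (c : List (List ℕ)) :
    killFixed (cyclesWeight c) = if fixSt c = 0 then Polynomial.X ^ capSt c else 0 := by
  have hfix : fixSt c = 0 ↔ ∀ w ∈ c, ¬ ∃ k, w = [k, k] := by
    rw [fixSt, Finset.card_eq_zero, Finset.filter_eq_empty_iff]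
    simp only [Finset.mem_range]
    constructor
    · intro h w hw
      obtain ⟨i, hi, rfl⟩ := List.getElem_of_mem hw
      simpa [hi] using h hi
    · intro h i hi
      simpa [hi] using h _ (List.getElem_mem hi)
  have hcap : capSt c = (c.map ascPlat).sum := by
    simp only [capSt, card_filter_eq_ascPlat]
  have hword : ∀ w, killFixed (wordWeight w) =
      if ∃ k, w = [k, k] then 0 else Polynomial.X ^ ascPlat w := by
    intro w
    unfold wordWeight
    split_ifs <;> simp [killFixed_X]
  rw [cyclesWeight, map_list_prod, List.map_map]
  split_ifs with h
  · rw [hfix] at h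
    rw [hcap, List.map_congr_left (g := fun w => Polynomial.X ^ ascPlat w)
      fun w hw => by simp [hword, h w hw]]
    clear hfix hcap h
    induction c with
    | nil => simp
    | cons w c ih => simp [ih, pow_add]
  · rw [hfix] at h
    push Not at h
    obtain ⟨w, hw, hk⟩ := h
    exact List.prod_eq_zero (List.mem_map.2 ⟨w, hw, by simp [hword, hk]⟩)

/-! ### The recursive structure of Stirling permutations of the second kind -/

lemma isStirlingWord_iff_sublist {l : List ℕ} :
    IsStirlingWord l ↔ ∀ a b, [a, b, a].Sublist l → a < b := by
  constructor
  · intro h a b hs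
    obtain ⟨f, hf⟩ := List.sublist_iff_exists_fin_orderEmbedding_get_eq.1 hs
    have h0 : a = l.get (f ⟨0, by simp⟩) := hf ⟨0, by simp⟩
    have h1 : b = l.get (f ⟨1, by simp⟩) := hf ⟨1, by simp⟩
    have h2 : a = l.get (f ⟨2, by simp⟩) := hf ⟨2, by simp⟩
    rw [h0, h1]
    exact h _ _ (f ⟨2, by simp⟩) (f.strictMono (by simp)) (f.strictMono (by simp)) (h0 ▸ h2)
  · intro h i j k hij hjk hik
    refine h _ _ ?_
    have := List.map_getElem_sublist (l := l) (is := [i, j, k])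
      (by simp [hij, hjk, hij.trans hjk])
    simp only [List.get_eq_getElem] at hik
    simpa [← hik] using this

/-- The conditions on a single cycle in `IsStirling2`. -/
def IsCycleWord (w : List ℕ) : Prop :=
  w ≠ [] ∧ (∀ v ∈ w, w.count v = 2) ∧ (∀ v ∈ w, w.headI ≤ v) ∧ IsStirlingWord w

lemma IsCycleWord.even_length {w : List ℕ} (hw : IsCycleWord w) : Even w.length := by
  rw [← List.sum_toFinset_count_eq_length]
  refine Finset.even_sum _ fun a ha => ?_
  rw [hw.2.1 a (List.mem_toFinset.1 ha)]
  exact even_two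

lemma isCycleWord_pair (m : ℕ) : IsCycleWord [m, m] := by
  refine ⟨by simp, by simp, by simp, isStirlingWord_iff_sublist.2 fun a b h => ?_⟩
  simpa using h.length_le

lemma isStirlingWord_insert {m : ℕ} {u v : List ℕ} (hm : ∀ a ∈ u ++ v, a < m) :
    IsStirlingWord (u ++ m :: m :: v) ↔ IsStirlingWord (u ++ v) := by
  rw [isStirlingWord_iff_sublist, isStirlingWord_iff_sublist]
  have hfilter : (u ++ m :: m :: v).filter (· ≠ m) = u ++ v := by
    rw [List.filter_append, List.filter_cons_of_neg (by simp), List.filter_cons_of_neg (by simp),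
      ← List.filter_append, List.filter_eq_self]
    exact fun a ha => by simpa using (hm a ha).ne
  have hu : m ∉ u := fun h => (hm m (by simp [h])).false
  have hv : m ∉ v := fun h => (hm m (by simp [h])).false
  refine ⟨fun h a b hs => h a b (hs.trans ?_), fun h a b hs => ?_⟩
  · exact List.Sublist.append_left ((List.sublist_cons_self _ _).trans
      (List.sublist_cons_self _ _)) _
  · have hmem : ∀ x ∈ u ++ m :: m :: v, x ≤ m := by
      intro x hx
      by_cases hxm : x = m
      · exact hxm.le
      · exact (hm x (by simp_all)).le
    by_cases ha : a = m
    · subst ha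
      exfalso
      have hab : b ≠ a := by
        rintro rfl
        have h3 := hs.count_le b
        simp [List.count_eq_zero_of_not_mem hu, List.count_eq_zero_of_not_mem hv] at h3
      obtain ⟨l₁, l₂, he, h1, h2⟩ := List.sublist_append_iff.1 hs
      match l₁ with
      | [] =>
        obtain rfl : l₂ = [a, b, a] := by simpa using he.symm
        have h2 := List.cons_sublist_cons.1 h2
        have h2 := (List.sublist_cons_iff.1 h2).resolve_right (by simp [hab])
        exact hv (h2.subset (by simp))
      | x :: l₁ =>
        obtain ⟨rfl, -⟩ := List.cons.inj he
        exact hu (h1.subset (by simp))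
    · by_cases hb : b = m
      · subst hb
        exact lt_of_le_of_ne (hmem a (hs.subset (by simp))) ha
      · have := hs.filter (· ≠ m)
        rw [hfilter] at this
        exact h a b (by simpa [ha, hb] using this)

lemma isCycleWord_insert {m : ℕ} {u v : List ℕ} (hu : u ≠ []) (hm : ∀ a ∈ u ++ v, a < m) :
    IsCycleWord (u ++ m :: m :: v) ↔ IsCycleWord (u ++ v) := by
  have hm' : m ∉ u ++ v := fun h => (hm m h).false
  have hc : ∀ a, (u ++ m :: m :: v).count a = (u ++ v).count a + if a = m then 2 else 0 := by
    intro a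
    by_cases h : a = m
    · subst h; simp [List.count_append]; omega
    · simp [List.count_append, Ne.symm h, h]
  have h0 := List.count_eq_zero_of_not_mem hm'
  have hmem : ∀ a, a ∈ u ++ m :: m :: v ↔ a = m ∨ a ∈ u ++ v := by
    intro a; simp; tauto
  match u, hu with
  | b :: u, _ =>
    have hb : b < m := hm b (by simp)
    unfold IsCycleWord
    rw [isStirlingWord_insert hm]
    refine and_congr (by simp) (and_congr ?_ (and_congr_left' ?_))
    · simp only [hmem, hc, forall_eq_or_imp, h0, if_true, true_and, zero_add]
      exact forall₂_congr fun a ha => by rw [if_neg (hm a ha).ne, add_zero]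
    · simp only [hmem, forall_eq_or_imp]
      simp [hb.le]

lemma exists_eq_append_of_mem_max {m : ℕ} {w : List ℕ} (hw : IsCycleWord w)
    (hm : ∀ a ∈ w, a ≤ m) (hmw : m ∈ w) : ∃ u v, w = u ++ m :: m :: v := by
  obtain ⟨u, t, rfl, hu⟩ := List.eq_append_cons_of_mem hmw
  have hcount := hw.2.1 m hmw
  have hmt : m ∈ t := by
    by_contra ht
    simp [List.count_eq_zero_of_not_mem hu, List.count_eq_zero_of_not_mem ht] at hcount
  match t, hmt with
  | b :: t, hmt =>
    obtain rfl : b = m := by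
      by_contra hb
      have hmt : m ∈ t := (List.mem_cons.1 hmt).resolve_left (Ne.symm hb)
      have hlt : m < b := isStirlingWord_iff_sublist.1 hw.2.2.2 m b <|
        (((List.singleton_sublist.2 hmt).cons_cons b).cons_cons m).trans
          (List.sublist_append_right _ _)
      exact hlt.not_ge (hm b (by simp))
    exact ⟨u, t, rfl⟩

lemma baseList_succ (n : ℕ) : baseList (n + 1) = baseList n ++ [n + 1, n + 1] := by
  simp [baseList, List.range_succ]

lemma le_of_mem_baseList {n a : ℕ} (ha : a ∈ baseList n) : a ≤ n := by
  simp only [baseList, List.mem_flatMap, List.mem_range] at ha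
  obtain ⟨i, hi, ha⟩ := ha
  simp at ha
  omega

lemma length_baseList (n : ℕ) : (baseList n).length = 2 * n := by
  induction n with
  | zero => rfl
  | succ n ih => rw [baseList_succ, List.length_append, ih]; rfl

lemma isStirling2_iff {n : ℕ} {c : List (List ℕ)} : IsStirling2 n c ↔
    c.flatten.Perm (baseList n) ∧ (∀ w ∈ c, IsCycleWord w) ∧
      (c.map List.headI).IsChain (· < ·) := by
  rw [List.isChain_map]
  rfl

lemma mem_stirling2 {n : ℕ} {c : List (List ℕ)} : c ∈ stirling2 n ↔ IsStirling2 n c := by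
  rw [stirling2, Finset.mem_filter, and_iff_right_iff_imp]
  intro hc
  have hsplit : ∀ N, c.flatten.length = N →
      ∃ p : Composition N, c.flatten.splitWrtComposition p = c := by
    rintro _ rfl
    refine ⟨⟨c.map List.length, ?_, (List.length_flatten).symm⟩,
      List.splitWrtComposition_flatten _ _ rfl⟩
    intro i hi
    obtain ⟨w, hw, rfl⟩ := List.mem_map.1 hi
    exact List.length_pos_iff.2 (hc.2.1 w hw).1
  obtain ⟨p, hp⟩ := hsplit (2 * n) (by rw [hc.1.length_eq, length_baseList])
  refine Finset.mem_image.2 ⟨(c.flatten, p), ?_, hp⟩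
  simpa using hc.1

lemma IsStirling2.le_of_mem {n : ℕ} {c : List (List ℕ)} (hc : IsStirling2 n c) {w : List ℕ}
    (hw : w ∈ c) {a : ℕ} (ha : a ∈ w) : a ≤ n :=
  le_of_mem_baseList (hc.1.subset (List.mem_flatten.2 ⟨w, hw, ha⟩))

lemma flatten_insert_perm (m : ℕ) (c₁ c₂ : List (List ℕ)) (u v : List ℕ) :
    (c₁ ++ (u ++ m :: m :: v) :: c₂).flatten.Perm
      ((c₁ ++ (u ++ v) :: c₂).flatten ++ [m, m]) := by
  rw [List.perm_iff_count]
  intro a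
  simp only [List.flatten_append, List.flatten_cons, List.count_append, List.count_cons,
    List.count_nil]
  omega

lemma headI_insert {u : List ℕ} (hu : u ≠ []) (v v' : List ℕ) :
    (u ++ v).headI = (u ++ v').headI := by
  cases u <;> simp_all

lemma isStirling2_insert {n : ℕ} {c₁ c₂ : List (List ℕ)} {u v : List ℕ} (hu : u ≠ [])
    (hm : ∀ a ∈ u ++ v, a < n + 1) :
    IsStirling2 (n + 1) (c₁ ++ (u ++ (n + 1) :: (n + 1) :: v) :: c₂) ↔
      IsStirling2 n (c₁ ++ (u ++ v) :: c₂) := by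
  rw [isStirling2_iff, isStirling2_iff, baseList_succ,
    (flatten_insert_perm (n + 1) c₁ c₂ u v).congr_left, List.perm_append_right_iff]
  simp only [List.mem_append, List.mem_cons, or_imp, forall_and, forall_eq, List.map_append,
    List.map_cons, isCycleWord_insert hu hm, headI_insert hu _ v]

lemma headI_mem {w : List ℕ} (hw : w ≠ []) : w.headI ∈ w := by
  cases w <;> simp_all

lemma isStirling2_append_pair {n : ℕ} {c : List (List ℕ)} :
    IsStirling2 (n + 1) (c ++ [[n + 1, n + 1]]) ↔ IsStirling2 n c := by
  constructor <;> intro h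
  · have h' := isStirling2_iff.1 h
    refine isStirling2_iff.2 ⟨?_, fun w hw => h'.2.1 w (by simp [hw]), ?_⟩
    · simpa [baseList_succ, List.perm_append_right_iff] using h'.1
    · have := h'.2.2
      rw [List.map_append, List.isChain_append] at this
      exact this.1
  · have h' := isStirling2_iff.1 h
    refine isStirling2_iff.2 ⟨?_, ?_, ?_⟩
    · simpa [baseList_succ, List.perm_append_right_iff] using h'.1
    · simpa [or_imp, forall_and, isCycleWord_pair] using h'.2.1
    · rw [List.map_append, List.isChain_append]
      refine ⟨h'.2.2, by simp, fun x hx y hy => ?_⟩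
      obtain rfl : n + 1 = y := by simpa using hy
      obtain ⟨w, hw, rfl⟩ := List.mem_map.1 (List.mem_of_mem_getLast? hx)
      exact Nat.lt_succ_of_le (h.le_of_mem hw (headI_mem (h'.2.1 w hw).1))

lemma isStirling2_succ_iff {n : ℕ} {c' : List (List ℕ)} :
    IsStirling2 (n + 1) c' ↔ ∃ c, IsStirling2 n c ∧ c' ∈ insertLetter (n + 1) c := by
  constructor
  · intro h
    have h' := isStirling2_iff.1 h
    have hmem : n + 1 ∈ c'.flatten := h.1.symm.subset (by simp [baseList_succ])
    obtain ⟨w, hw, hmw⟩ := List.mem_flatten.1 hmem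
    obtain ⟨u, v, rfl⟩ := exists_eq_append_of_mem_max (h'.2.1 w hw)
      (fun a ha => h.le_of_mem hw ha) hmw
    obtain ⟨c₁, c₂, rfl⟩ := List.append_of_mem hw
    have hperm : (c₁ ++ (u ++ v) :: c₂).flatten.Perm (baseList n) := by
      rw [← List.perm_append_right_iff [n + 1, n + 1], ← baseList_succ]
      exact (flatten_insert_perm _ _ _ _ _).symm.trans h.1
    have hle : ∀ w ∈ c₁ ++ (u ++ v) :: c₂, ∀ a ∈ w, a < n + 1 := fun w hw a ha =>
      Nat.lt_succ_of_le (le_of_mem_baseList (hperm.subset (List.mem_flatten.2 ⟨w, hw, ha⟩)))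
    have hm : ∀ a ∈ u ++ v, a < n + 1 := hle _ (by simp)
    by_cases hu : u = []
    · subst hu
      have hv : v = [] := by
        refine List.eq_nil_iff_forall_not_mem.2 fun a ha => ?_
        exact (hm a (by simpa using ha)).not_ge ((h'.2.1 _ hw).2.2.1 a (by simp [ha]))
      subst hv
      have hc₂ : c₂ = [] := by
        match c₂ with
        | [] => rfl
        | w₂ :: c₂ =>
          have hch := h'.2.2
          rw [List.map_append, List.isChain_append] at hch
          have hlt : n + 1 < w₂.headI := by
            have := hch.2.1
            simp only [List.map_cons, List.isChain_cons_cons] at this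
            exact this.1
          exact absurd (hle w₂ (by simp) _
            (headI_mem (h'.2.1 w₂ (by simp)).1)) hlt.not_gt
      subst hc₂
      exact ⟨c₁, isStirling2_append_pair.1 h, by simp [insertLetter]⟩
    · exact ⟨_, (isStirling2_insert hu hm).1 h,
        List.mem_cons_of_mem _ (mem_insertCycles.2 ⟨c₁, c₂, u, v, hu, rfl, rfl⟩)⟩
  · rintro ⟨c, hc, hmem⟩
    rcases List.mem_cons.1 hmem with rfl | hmem
    · exact isStirling2_append_pair.2 hc
    · obtain ⟨c₁, c₂, u, v, hu, rfl, rfl⟩ := mem_insertCycles.1 hmem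
      exact (isStirling2_insert hu fun a ha =>
        Nat.lt_succ_of_le (hc.le_of_mem (by simp) ha)).2 hc

/-- Deleting the letter `m` from a list of cycles, discarding empty cycles. -/
def eraseLetter (m : ℕ) (c : List (List ℕ)) : List (List ℕ) :=
  (c.map (List.filter (· ≠ m))).filter (· ≠ [])

lemma eraseLetter_of_mem_insertLetter {m : ℕ} {c c' : List (List ℕ)} (hne : ∀ w ∈ c, w ≠ [])
    (hm : ∀ w ∈ c, m ∉ w) (hc' : c' ∈ insertLetter m c) : eraseLetter m c' = c := by
  have hfilter : ∀ l : List ℕ, m ∉ l → l.filter (· ≠ m) = l := fun l hl =>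
    List.filter_eq_self.2 fun a ha => decide_eq_true fun h : a = m => hl (h ▸ ha)
  have hmap : ∀ l : List (List ℕ), (∀ w ∈ l, m ∉ w) → l.map (List.filter (· ≠ m)) = l :=
    fun l hl => (List.map_congr_left fun w hw => hfilter w (hl w hw)).trans l.map_id'
  have hself : c.filter (· ≠ []) = c := List.filter_eq_self.2 fun w hw => by simpa using hne w hw
  rcases List.mem_cons.1 hc' with rfl | hc'
  · rw [eraseLetter, List.map_append, hmap c hm, List.filter_append, hself]
    simp
  · obtain ⟨c₁, c₂, u, v, hu, rfl, rfl⟩ := mem_insertCycles.1 hc'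
    have hins : (u ++ m :: m :: v).filter (· ≠ m) = u ++ v := by
      rw [List.filter_append, List.filter_cons_of_neg (by simp),
        List.filter_cons_of_neg (by simp), ← List.filter_append]
      exact hfilter _ (hm _ (by simp))
    rw [eraseLetter, List.map_append, List.map_cons, hins,
      hmap c₁ fun w hw => hm w (by simp [hw]), hmap c₂ fun w hw => hm w (by simp [hw]), hself]

lemma nodup_insertWord {m : ℕ} {w : List ℕ} (hm : m ∉ w) : (insertWord m w).Nodup := by
  induction w with
  | nil => simp [insertWord]
  | cons a w ih =>
    rw [insertWord, List.nodup_cons]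
    refine ⟨fun h => ?_, (ih fun h => hm (by simp [h])).map (List.cons_injective)⟩
    obtain ⟨x, hx, he⟩ := List.mem_map.1 h
    obtain ⟨u, v, hu, rfl, rfl⟩ := mem_insertWord.1 hx
    match u, hu with
    | b :: u, _ =>
      simp only [List.cons_append, List.cons.injEq] at he
      exact hm (by simp [he.2.1])

lemma nodup_insertLetter {m : ℕ} {c : List (List ℕ)} (hm : ∀ w ∈ c, m ∉ w) :
    (insertLetter m c).Nodup := by
  rw [insertLetter, List.nodup_cons]
  constructor
  · intro h
    obtain ⟨c₁, c₂, u, v, hu, rfl, he⟩ := mem_insertCycles.1 h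
    simpa using congrArg List.length he
  · induction c with
    | nil => simp [insertCycles]
    | cons w c ih =>
      rw [insertCycles, List.nodup_append']
      refine ⟨(nodup_insertWord (hm w (by simp))).map fun _ _ h => (List.cons.inj h).1,
        (ih fun w hw => hm w (by simp [hw])).map List.cons_injective, ?_⟩
      intro x hx hx'
      obtain ⟨w', hw', rfl⟩ := List.mem_map.1 hx
      obtain ⟨c', hc', he⟩ := List.mem_map.1 hx'
      obtain ⟨u, v, hu, rfl, rfl⟩ := mem_insertWord.1 hw'
      have hlen := congrArg List.length (List.cons.inj he).1
      simp at hlen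
      omega

/-- The generating polynomial of all Stirling permutations of the second kind. -/
def stirlingPoly (n : ℕ) : WeightRing := ∑ c ∈ stirling2 n, cyclesWeight c

lemma stirling2_succ (n : ℕ) :
    stirling2 (n + 1) = (stirling2 n).biUnion fun c => (insertLetter (n + 1) c).toFinset := by
  ext c'
  simp only [mem_stirling2, isStirling2_succ_iff, Finset.mem_biUnion, List.mem_toFinset]

lemma stirlingPoly_zero : stirlingPoly 0 = 1 := by
  have h : stirling2 0 = {[]} := by
    ext c
    rw [mem_stirling2, Finset.mem_singleton]
    constructor
    · intro h
      have hnil : c.flatten = [] := h.1.eq_nil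
      rw [List.flatten_eq_nil_iff] at hnil
      exact List.eq_nil_iff_forall_not_mem.2 fun w hw => (h.2.1 w hw).1 (hnil w hw)
    · rintro rfl
      exact isStirling2_iff.2 (by simp [baseList])
  rw [stirlingPoly, h]
  simp [cyclesWeight]

lemma stirlingPoly_succ (n : ℕ) : stirlingPoly (n + 1) =
    MvPolynomial.X 1 * stirlingPoly n + 2 * grammarDer (stirlingPoly n) := by
  have hnot : ∀ c ∈ stirling2 n, ∀ w ∈ c, n + 1 ∉ w := fun c hc w hw h =>
    absurd ((mem_stirling2.1 hc).le_of_mem hw h) (by simp)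
  have herase : ∀ c ∈ stirling2 n, ∀ c' ∈ insertLetter (n + 1) c, eraseLetter (n + 1) c' = c :=
    fun c hc c' => eraseLetter_of_mem_insertLetter
      (fun w hw => ((mem_stirling2.1 hc).2.1 w hw).1) (hnot c hc)
  rw [stirlingPoly, stirling2_succ, Finset.sum_biUnion, stirlingPoly, map_sum, Finset.mul_sum,
    Finset.mul_sum, ← Finset.sum_add_distrib]
  · refine Finset.sum_congr rfl fun c hc => ?_
    rw [List.sum_toFinset _ (nodup_insertLetter (hnot c hc)), sum_cyclesWeight_insertLetter]
    have hs := mem_stirling2.1 hc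
    exact fun w hw => ⟨(hs.2.1 w hw).1, IsCycleWord.even_length (hs.2.1 w hw),
      fun a ha => Nat.lt_succ_of_le (hs.le_of_mem hw ha)⟩
  · intro c hc d hd hcd
    refine Finset.disjoint_left.2 fun c' h1 h2 => hcd ?_
    rw [← herase c hc c' (List.mem_toFinset.1 h1), herase d hd c' (List.mem_toFinset.1 h2)]

lemma killFixed_stirlingPoly (n : ℕ) : killFixed (stirlingPoly n) = Rx n := by
  rw [stirlingPoly, Rx, map_sum, Finset.sum_filter]
  exact Finset.sum_congr rfl fun c _ => killFixed_cyclesWeight c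

/-- For every `n ≥ 0`:  `2^n d_n(x) = ∑_{k=0}^n C(n,k) R_k(x) R_{n-k}(x)`. -/
theorem stmt18 (n : ℕ) :
    (2 : Polynomial ℚ) ^ n * dpoly n =
      ∑ k ∈ Finset.range (n + 1), (n.choose k : Polynomial ℚ) * Rx k * Rx (n - k) := by
  have h := congrArg killFixed (convolution_recurrence grammarDer (MvPolynomial.X 1) permPoly
    stirlingPoly (by simp [permPoly, permWeight]) stirlingPoly_zero permPoly_succ
    stirlingPoly_succ n)
  simpa only [map_mul, map_pow, map_sum, map_ofNat, map_natCast, killFixed_permPoly,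
    killFixed_stirlingPoly] using h
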